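/- arXiv:1907.11509 — 2 statements merged into one kernel-verified Lean document; each statement's English description precedes it below -/
import Mathlib

section
/- Let α ∈ ℂ, let I ⊆ ℝ∖{0} be an open interval, and let u, v : I → ℂ be differentiable functions satisfying s·u′ = (1/2)s·u − 2u²v(v²−1) + 2α·uv and s·v′ = −(1/2)s·v + u(v²−1)² − α(v²−1) on I, with v(s) ∉ {1, −1} for all s ∈ I. Then v is twice differentiable and satisfies v″ − (2v/(v²−1))·(v′)² + v′/s + v/(2s) + v(v²+1)/(4(v²−1)) + α(v²+1)/(2s) = 0 on I; moreover, the function w := (v+1)/(v−1) is nonvanishing on I and satisfies the Painlevé III equation w″ − (1/w)(w′)² + w′/s − (1/(2s))·((α + 1/2)·w² + (α − 1/2)) − w³/16 + 1/(16w) = 0 on I. -/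
open Complex

/-- The Möbius transform `w = (v+1)/(v−1)`. -/
noncomputable def pvMob (v : ℝ → ℂ) (s : ℝ) : ℂ := (v s + 1) / (v s - 1)

/-- The derivative of the right-hand side of the reduced system, solved for `v′`. -/
lemma hasDerivAt_reduced_rhs {α u' v' : ℂ} {u v : ℝ → ℂ} {s : ℝ} (hs : (s : ℂ) ≠ 0)
    (hu : HasDerivAt u u' s) (hv : HasDerivAt v v' s) :
    HasDerivAt
      (fun t : ℝ => (-(1/2) * (t : ℂ) * v t + u t * ((v t) ^ 2 - 1) ^ 2
        - α * ((v t) ^ 2 - 1)) / (t : ℂ))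
      (((-(1/2) * v s - (1/2) * (s : ℂ) * v' + u' * ((v s) ^ 2 - 1) ^ 2
        + 4 * u s * v s * ((v s) ^ 2 - 1) * v' - 2 * α * v s * v') * (s : ℂ)
        - (-(1/2) * (s : ℂ) * v s + u s * ((v s) ^ 2 - 1) ^ 2
          - α * ((v s) ^ 2 - 1))) / (s : ℂ) ^ 2) s := by
  have hid : HasDerivAt (fun t : ℝ => (t : ℂ)) 1 s := Complex.ofRealCLM.hasDerivAt
  have hD := (hv.fun_pow 2).sub_const 1
  refine (((((hid.const_mul (-(1/2) : ℂ)).fun_mul hv).fun_add (hu.fun_mul (hD.fun_pow 2))).fun_sub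
    (hD.const_mul α)).fun_div hid hs).congr_deriv ?_
  push_cast
  ring

/-- The derivative of the Möbius transform away from its pole. -/
lemma hasDerivAt_pvMob {v : ℝ → ℂ} {v' : ℂ} {s : ℝ} (hv : HasDerivAt v v' s)
    (h1 : v s - 1 ≠ 0) : HasDerivAt (pvMob v) (-2 * v' / (v s - 1) ^ 2) s := by
  refine ((hv.add_const 1).fun_div (hv.sub_const 1) h1).congr_deriv ?_
  ring

/-- The pointwise second-order equation for `v`, from the differentiated system. -/
lemma second_order_identity {α s u v p u' : ℂ} (hs : s ≠ 0) (hD : v ^ 2 - 1 ≠ 0)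
    (hu : s * u' = (1/2) * s * u - 2 * u ^ 2 * v * (v ^ 2 - 1) + 2 * α * u * v)
    (hv : s * p = -(1/2) * s * v + u * (v ^ 2 - 1) ^ 2 - α * (v ^ 2 - 1)) :
    ((-(1/2) * v - (1/2) * s * p + u' * (v ^ 2 - 1) ^ 2
        + 4 * u * v * (v ^ 2 - 1) * p - 2 * α * v * p) * s
        - (-(1/2) * s * v + u * (v ^ 2 - 1) ^ 2 - α * (v ^ 2 - 1))) / s ^ 2
      - (2 * v / (v ^ 2 - 1)) * p ^ 2 + p / s + v / (2 * s)
      + v * (v ^ 2 + 1) / (4 * (v ^ 2 - 1)) + α * (v ^ 2 + 1) / (2 * s) = 0 := by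
  obtain rfl : u' = ((1/2) * s * u - 2 * u ^ 2 * v * (v ^ 2 - 1) + 2 * α * u * v) / s := by
    rw [← hu]; field_simp
  obtain rfl : p = (-(1/2) * s * v + u * (v ^ 2 - 1) ^ 2 - α * (v ^ 2 - 1)) / s := by
    rw [← hv]; field_simp
  field_simp
  ring

/-- The Möbius transform carries the second-order equation for `v` to Painlevé III. -/
lemma painleveIII_identity {α s v p q : ℂ} (hs : s ≠ 0) (h1 : v - 1 ≠ 0) (h2 : v + 1 ≠ 0)
    (h : q - (2 * v / (v ^ 2 - 1)) * p ^ 2 + p / s + v / (2 * s)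
      + v * (v ^ 2 + 1) / (4 * (v ^ 2 - 1)) + α * (v ^ 2 + 1) / (2 * s) = 0) :
    (-2 * q / (v - 1) ^ 2 + 4 * p ^ 2 / (v - 1) ^ 3)
      - (1 / ((v + 1) / (v - 1))) * (-2 * p / (v - 1) ^ 2) ^ 2
      + (-2 * p / (v - 1) ^ 2) / s
      - (1 / (2 * s)) * ((α + 1/2) * ((v + 1) / (v - 1)) ^ 2 + (α - 1/2))
      - ((v + 1) / (v - 1)) ^ 3 / 16 + 1 / (16 * ((v + 1) / (v - 1))) = 0 := by
  have hD : v ^ 2 - 1 = (v - 1) * (v + 1) := by ring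
  rw [hD] at h
  obtain rfl : q = (2 * v / ((v - 1) * (v + 1))) * p ^ 2 - p / s - v / (2 * s)
      - v * (v ^ 2 + 1) / (4 * ((v - 1) * (v + 1))) - α * (v ^ 2 + 1) / (2 * s) := by
    linear_combination h
  field_simp
  ring

/-- If `u, v` solve the reduced (β = 0) coupled Painlevé V system
`s·u′ = (1/2)s·u − 2u²v(v²−1) + 2αuv`, `s·v′ = −(1/2)s·v + u(v²−1)² − α(v²−1)`
on an open interval `I ⊆ ℝ∖{0}` with `v ∉ {1, −1}`, then `v` is twice
differentiable and satisfies
`v″ − (2v/(v²−1))v′² + v′/s + v/(2s) + v(v²+1)/(4(v²−1)) + α(v²+1)/(2s) = 0`,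
and `w = (v+1)/(v−1)` is nonvanishing and satisfies the Painlevé III equation
`w″ − w′²/w + w′/s − (1/(2s))((α+1/2)w² + (α−1/2)) − w³/16 + 1/(16w) = 0`. -/
theorem reduced_cpv_to_painleveIII
    (α : ℂ) (I : Set ℝ) (hIopen : IsOpen I) (hIconn : I.OrdConnected)
    (hI0 : (0 : ℝ) ∉ I) (u v : ℝ → ℂ)
    (hdiff : ∀ s ∈ I, DifferentiableAt ℝ u s ∧ DifferentiableAt ℝ v s)
    (hv1 : ∀ s ∈ I, v s ≠ 1 ∧ v s ≠ -1)
    (hu : ∀ s ∈ I, (s : ℂ) * deriv u s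
      = (1/2) * (s : ℂ) * u s - 2 * (u s) ^ 2 * v s * ((v s) ^ 2 - 1)
          + 2 * α * u s * v s)
    (hv : ∀ s ∈ I, (s : ℂ) * deriv v s
      = -(1/2) * (s : ℂ) * v s + u s * ((v s) ^ 2 - 1) ^ 2 - α * ((v s) ^ 2 - 1)) :
    (∀ s ∈ I,
      DifferentiableAt ℝ (deriv v) s ∧
      deriv (deriv v) s - (2 * v s / ((v s) ^ 2 - 1)) * (deriv v s) ^ 2
        + deriv v s / (s : ℂ) + v s / (2 * (s : ℂ))
        + v s * ((v s) ^ 2 + 1) / (4 * ((v s) ^ 2 - 1))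
        + α * ((v s) ^ 2 + 1) / (2 * (s : ℂ)) = 0) ∧
    (∀ s ∈ I,
      pvMob v s ≠ 0 ∧
      DifferentiableAt ℝ (pvMob v) s ∧
      DifferentiableAt ℝ (deriv (pvMob v)) s ∧
      deriv (deriv (pvMob v)) s - (1 / pvMob v s) * (deriv (pvMob v) s) ^ 2
        + deriv (pvMob v) s / (s : ℂ)
        - (1 / (2 * (s : ℂ))) * ((α + 1/2) * (pvMob v s) ^ 2 + (α - 1/2))
        - (pvMob v s) ^ 3 / 16 + 1 / (16 * pvMob v s) = 0) := by
  have hs0 : ∀ s ∈ I, (s : ℂ) ≠ 0 := fun s hs h =>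
    hI0 (Complex.ofReal_eq_zero.mp h ▸ hs)
  have hm : ∀ s ∈ I, v s - 1 ≠ 0 := fun s hs => sub_ne_zero.mpr (hv1 s hs).1
  have hp : ∀ s ∈ I, v s + 1 ≠ 0 := fun s hs h => (hv1 s hs).2 (eq_neg_of_add_eq_zero_left h)
  have hv' : ∀ s ∈ I, HasDerivAt v (deriv v s) s := fun s hs => (hdiff s hs).2.hasDerivAt
  have hv'' : ∀ s ∈ I, HasDerivAt (deriv v) _ s := fun s hs =>
    (hasDerivAt_reduced_rhs (α := α) (hs0 s hs) (hdiff s hs).1.hasDerivAt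
      (hv' s hs)).congr_of_eventuallyEq <| by
        filter_upwards [hIopen.mem_nhds hs] with t ht
        rw [eq_div_iff (hs0 t ht), mul_comm, hv t ht]
  have hode : ∀ s ∈ I, deriv (deriv v) s - (2 * v s / ((v s) ^ 2 - 1)) * (deriv v s) ^ 2
        + deriv v s / (s : ℂ) + v s / (2 * (s : ℂ))
        + v s * ((v s) ^ 2 + 1) / (4 * ((v s) ^ 2 - 1))
        + α * ((v s) ^ 2 + 1) / (2 * (s : ℂ)) = 0 := fun s hs => by
    have hD : (v s) ^ 2 - 1 ≠ 0 := by
      convert mul_ne_zero (hm s hs) (hp s hs) using 1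
      ring
    rw [(hv'' s hs).deriv]
    exact second_order_identity (hs0 s hs) hD (hu s hs) (hv s hs)
  refine ⟨fun s hs => ⟨(hv'' s hs).differentiableAt, hode s hs⟩, fun s hs => ?_⟩
  have hw := hasDerivAt_pvMob (hv' s hs) (hm s hs)
  have hw' : HasDerivAt (deriv (pvMob v))
      (-2 * deriv (deriv v) s / (v s - 1) ^ 2 + 4 * (deriv v s) ^ 2 / (v s - 1) ^ 3) s := by
    have hquot : HasDerivAt (fun t => -2 * deriv v t / (v t - 1) ^ 2)
        (-2 * deriv (deriv v) s / (v s - 1) ^ 2 + 4 * (deriv v s) ^ 2 / (v s - 1) ^ 3) s := by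
      have h1 := hm s hs
      refine (((hv'' s hs).differentiableAt.hasDerivAt.const_mul (-2 : ℂ)).fun_div
        (((hv' s hs).sub_const 1).fun_pow 2) (pow_ne_zero 2 h1)).congr_deriv ?_
      field_simp
      push_cast
      ring
    refine hquot.congr_of_eventuallyEq ?_
    filter_upwards [hIopen.mem_nhds hs] with t ht
    exact (hasDerivAt_pvMob (hv' t ht) (hm t ht)).deriv
  refine ⟨div_ne_zero (hp s hs) (hm s hs), hw.differentiableAt, hw'.differentiableAt, ?_⟩
  rw [hw'.deriv, hw.deriv]
  exact painleveIII_identity (hs0 s hs) (hm s hs) (hp s hs) (hode s hs)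
end

section
/- Let α ∈ ℝ and define D(ζ) := ((−i + √(ζ²−1))/ζ)^α for ζ ∈ ℂ∖[−1, 1], where √(ζ²−1) is the branch analytic on ℂ∖[−1,1] that behaves like ζ at infinity (determined by arg(ζ±1) ∈ (−π, π)), and the power and ζ^α are taken with principal branches (arg ∈ (−π, π)). Then: (i) D is well-defined, analytic and nonvanishing on ℂ∖[−1, 1]; (ii) its boundary values from above and below the cut satisfy D₊(x)·D₋(x) = e^{iπα} for x ∈ (−1, 0) and D₊(x)·D₋(x) = e^{−iπα} for x ∈ (0, 1), where D₊(x) = lim_{ε→0⁺} D(x+iε) and D₋(x) = lim_{ε→0⁺} D(x−iε); (iii) D(ζ) = 1 − iα/ζ + O(1/ζ²) as ζ → ∞; (iv) as ζ → 0 with Im ζ > 0, D(ζ) = e^{−iπα/2}·(ζ/2)^α·(1 + O(ζ)); and (v) as ζ → ±1 with Im ζ > 0, D(ζ) = e^{∓iπα/2}·(1 + O(√(ζ²−1))). -/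
open Complex Filter Topology

/-- The branch of `√(ζ²−1)` analytic on `ℂ∖[−1,1]` that behaves like `ζ` at
infinity, determined by `arg(ζ±1) ∈ (−π, π)`: `(ζ−1)^{1/2}(ζ+1)^{1/2}` with
principal powers. -/
noncomputable def sqrtBr (ζ : ℂ) : ℂ := (ζ - 1) ^ ((1 : ℂ)/2) * (ζ + 1) ^ ((1 : ℂ)/2)

/-- The Szegő function `D(ζ) = ((−i + √(ζ²−1))/ζ)^α`, principal branches. -/
noncomputable def szegoD (α : ℝ) (ζ : ℂ) : ℂ :=
  ((-Complex.I + sqrtBr ζ) / ζ) ^ (α : ℂ)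

/-- The segment `[−1, 1]` viewed as a subset of `ℂ`. -/
noncomputable def segOne : Set ℂ := (fun x : ℝ => (x : ℂ)) '' Set.Icc (-1 : ℝ) 1

lemma notMem_segOne_iff {ζ : ℂ} : ζ ∉ segOne ↔ ζ.im ≠ 0 ∨ 1 < |ζ.re| := by
  rw [← not_iff_not]
  push Not
  rw [abs_le]
  constructor
  · rintro ⟨x, hx, rfl⟩
    exact ⟨by simp, by simpa using hx⟩
  · rintro ⟨h0, h1⟩
    exact ⟨ζ.re, h1, Complex.ext (by simp) (by simp [h0])⟩

lemma ne_zero_of_notMem_segOne {ζ : ℂ} (h : ζ ∉ segOne) : ζ ≠ 0 := by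
  rintro rfl
  exact h ⟨0, by norm_num, by simp⟩

lemma isOpen_segOne_compl : IsOpen segOneᶜ :=
  (isCompact_Icc.image continuous_ofReal).isClosed.isOpen_compl

lemma sqrtBr_sq (ζ : ℂ) : sqrtBr ζ ^ 2 = ζ ^ 2 - 1 := by
  have h (z : ℂ) : (z ^ ((1 : ℂ) / 2)) ^ 2 = z := by
    rw [one_div]
    exact cpow_nat_inv_pow z two_ne_zero
  rw [sqrtBr, mul_pow, h, h]
  ring

lemma exists_sqrtBr_eq_polar {ζ : ℂ} (h1 : ζ - 1 ≠ 0) (h2 : ζ + 1 ≠ 0) :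
    ∃ r : ℝ, 0 < r ∧ (sqrtBr ζ).re = r * Real.cos (((ζ - 1).arg + (ζ + 1).arg) / 2) ∧
      (sqrtBr ζ).im = r * Real.sin (((ζ - 1).arg + (ζ + 1).arg) / 2) := by
  have h : sqrtBr ζ = Complex.exp ((log (ζ - 1) + log (ζ + 1)) / 2) := by
    rw [sqrtBr, cpow_def_of_ne_zero h1, cpow_def_of_ne_zero h2, ← Complex.exp_add]
    ring_nf
  refine ⟨Real.exp ((log (ζ - 1) + log (ζ + 1)) / 2).re, Real.exp_pos _, ?_, ?_⟩
  · rw [h, Complex.exp_re]; simp [log_im]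
  · rw [h, Complex.exp_im]; simp [log_im]

lemma arg_mem_Ioo_of_im_pos {z : ℂ} (h : 0 < z.im) : z.arg ∈ Set.Ioo 0 Real.pi := by
  refine ⟨lt_of_le_of_ne (arg_nonneg_iff.2 h.le) fun h0 => ?_, arg_lt_pi_iff.2 (.inr h.ne')⟩
  exact h.ne' (arg_eq_zero_iff.1 h0.symm).2

lemma sqrtBr_im_pos {ζ : ℂ} (h : 0 < ζ.im) : 0 < (sqrtBr ζ).im := by
  have h1 : 0 < (ζ - 1).im := by simpa using h
  have h2 : 0 < (ζ + 1).im := by simpa using h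
  obtain ⟨r, hr, -, him⟩ := exists_sqrtBr_eq_polar (ζ := ζ)
    (fun h0 => by simp [h0] at h1) (fun h0 => by simp [h0] at h2)
  rw [him]
  obtain ⟨a1, b1⟩ := arg_mem_Ioo_of_im_pos h1
  obtain ⟨a2, b2⟩ := arg_mem_Ioo_of_im_pos h2
  exact mul_pos hr (Real.sin_pos_of_pos_of_lt_pi (by linarith) (by linarith))

lemma sqrtBr_im_neg {ζ : ℂ} (h : ζ.im < 0) : (sqrtBr ζ).im < 0 := by
  have h1 : (ζ - 1).im < 0 := by simpa using h
  have h2 : (ζ + 1).im < 0 := by simpa using h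
  obtain ⟨r, hr, -, him⟩ := exists_sqrtBr_eq_polar (ζ := ζ)
    (fun h0 => by simp [h0] at h1) (fun h0 => by simp [h0] at h2)
  rw [him]
  have a1 := arg_neg_iff.2 h1
  have a2 := arg_neg_iff.2 h2
  have b1 := neg_pi_lt_arg (ζ - 1)
  have b2 := neg_pi_lt_arg (ζ + 1)
  exact mul_neg_of_pos_of_neg hr
    (Real.sin_neg_of_neg_of_neg_pi_lt (by linarith) (by linarith))

lemma sqrtBr_of_one_lt {x : ℝ} (hx : 1 < x) : 0 < (sqrtBr x).re ∧ (sqrtBr x).im = 0 := by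
  have e1 : (x : ℂ) - 1 = ((x - 1 : ℝ) : ℂ) := by simp
  have e2 : (x : ℂ) + 1 = ((x + 1 : ℝ) : ℂ) := by simp
  obtain ⟨r, hr, hre, him⟩ := exists_sqrtBr_eq_polar (ζ := x)
    (by rw [e1]; exact_mod_cast (by linarith : x - 1 ≠ 0))
    (by rw [e2]; exact_mod_cast (by linarith : x + 1 ≠ 0))
  rw [e1, e2, arg_ofReal_of_nonneg (by linarith), arg_ofReal_of_nonneg (by linarith)] at hre him
  simp [hre, him, hr]

lemma sqrtBr_of_lt_neg_one {x : ℝ} (hx : x < -1) :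
    (sqrtBr x).re < 0 ∧ (sqrtBr x).im = 0 := by
  have e1 : (x : ℂ) - 1 = ((x - 1 : ℝ) : ℂ) := by simp
  have e2 : (x : ℂ) + 1 = ((x + 1 : ℝ) : ℂ) := by simp
  obtain ⟨r, hr, hre, him⟩ := exists_sqrtBr_eq_polar (ζ := x)
    (by rw [e1]; exact_mod_cast (by linarith : x - 1 < 0).ne)
    (by rw [e2]; exact_mod_cast (by linarith : x + 1 < 0).ne)
  rw [e1, e2, arg_ofReal_of_neg (by linarith), arg_ofReal_of_neg (by linarith)] at hre him
  simp [hre, him, hr]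

lemma re_div_pos_iff {s z : ℂ} (hz : z ≠ 0) :
    0 < (s / z).re ↔ 0 < s.re * z.re + s.im * z.im := by
  rw [Complex.div_re, ← add_div, div_pos_iff_of_pos_right (normSq_pos.2 hz)]

lemma sqrtBr_div_re_pos {ζ : ℂ} (h : ζ ∉ segOne) : 0 < (sqrtBr ζ / ζ).re := by
  rw [re_div_pos_iff (ne_zero_of_notMem_segOne h)]
  have hprod : (sqrtBr ζ).re * (sqrtBr ζ).im = ζ.re * ζ.im := by
    have := congrArg Complex.im (sqrtBr_sq ζ)
    simp [pow_two] at this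
    linarith
  have key (hb : 0 < (sqrtBr ζ).im * ζ.im) :
      0 < (sqrtBr ζ).re * ζ.re + (sqrtBr ζ).im * ζ.im := by
    have h1 : ((sqrtBr ζ).re * ζ.re) * ((sqrtBr ζ).im * ζ.im) = (ζ.re * ζ.im) ^ 2 := by
      rw [← hprod]
      linear_combination (-(sqrtBr ζ).re * (sqrtBr ζ).im) * hprod
    have h2 : 0 ≤ (sqrtBr ζ).re * ζ.re :=
      nonneg_of_mul_nonneg_left (h1 ▸ sq_nonneg _) hb
    linarith
  rcases lt_trichotomy ζ.im 0 with hi | hi | hi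
  · exact key (mul_pos_of_neg_of_neg (sqrtBr_im_neg hi) hi)
  · have hζ : ζ = (ζ.re : ℂ) := Complex.ext (by simp) (by simp [hi])
    rcases notMem_segOne_iff.1 h with h' | h'
    · exact absurd hi h'
    · rcases lt_abs.1 h' with h' | h'
      · have := (sqrtBr_of_one_lt h').1
        rw [← hζ] at this
        rw [hi]
        nlinarith
      · have := (sqrtBr_of_lt_neg_one (by linarith : ζ.re < -1)).1
        rw [← hζ] at this
        rw [hi]
        nlinarith
  · exact key (mul_pos (sqrtBr_im_pos hi) hi)

lemma sqrtBr_div_eq {ζ : ℂ} (h : ζ ∉ segOne) :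
    sqrtBr ζ / ζ = (1 - ζ⁻¹ ^ 2) ^ (2⁻¹ : ℂ) := by
  have h0 := ne_zero_of_notMem_segOne h
  rw [← sq_cpow_two_inv (sqrtBr_div_re_pos h), div_pow, sqrtBr_sq]
  congr 1
  field_simp

lemma sqrtBr_of_im_pos {ζ : ℂ} (h : 0 < ζ.im) :
    sqrtBr ζ = I * (1 - ζ ^ 2) ^ (2⁻¹ : ℂ) := by
  have hre : 0 < (-I * sqrtBr ζ).re := by simpa using sqrtBr_im_pos h
  have hsq : (-I * sqrtBr ζ) ^ 2 = 1 - ζ ^ 2 := by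
    rw [mul_pow, sqrtBr_sq, neg_sq, I_sq]
    ring
  rw [← hsq, sq_cpow_two_inv hre, ← mul_assoc]
  simp

lemma sqrtBr_of_im_neg {ζ : ℂ} (h : ζ.im < 0) :
    sqrtBr ζ = -I * (1 - ζ ^ 2) ^ (2⁻¹ : ℂ) := by
  have hre : 0 < (I * sqrtBr ζ).re := by simpa using sqrtBr_im_neg h
  have hsq : (I * sqrtBr ζ) ^ 2 = 1 - ζ ^ 2 := by
    rw [mul_pow, sqrtBr_sq, I_sq]
    ring
  rw [← hsq, sq_cpow_two_inv hre, ← mul_assoc]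
  simp

lemma sqrtBr_add_I_mul_sub_I (ζ : ℂ) : (sqrtBr ζ + I) * (-I + sqrtBr ζ) = ζ ^ 2 := by
  linear_combination sqrtBr_sq ζ - I_sq

lemma szegoD_base_re_pos {ζ : ℂ} (h : ζ ∉ segOne) : 0 < ((-I + sqrtBr ζ) / ζ).re := by
  have h0 := ne_zero_of_notMem_segOne h
  set w := (-I + sqrtBr ζ) / ζ with hw
  have hinv : w⁻¹ = (sqrtBr ζ + I) / ζ := by
    refine inv_eq_of_mul_eq_one_left ?_
    rw [hw, div_mul_div_comm, sqrtBr_add_I_mul_sub_I]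
    field_simp
  have hsum : w + w⁻¹ = (2 : ℝ) * (sqrtBr ζ / ζ) := by
    rw [hinv, hw]
    push_cast
    ring
  have hre := congrArg Complex.re hsum
  rw [re_ofReal_mul, add_re, inv_re] at hre
  have hpos := sqrtBr_div_re_pos h
  by_contra hle
  have : w.re / normSq w ≤ 0 := div_nonpos_of_nonpos_of_nonneg (not_lt.1 hle) (normSq_nonneg w)
  linarith

lemma szegoD_base_mem_slitPlane {ζ : ℂ} (h : ζ ∉ segOne) :
    (-I + sqrtBr ζ) / ζ ∈ slitPlane :=
  .inl (szegoD_base_re_pos h)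

lemma one_sub_inv_sq_mem_slitPlane {ζ : ℂ} (h : ζ ∉ segOne) : 1 - ζ⁻¹ ^ 2 ∈ slitPlane := by
  have hsq : (sqrtBr ζ / ζ) ^ 2 = 1 - ζ⁻¹ ^ 2 := by
    have h0 := ne_zero_of_notMem_segOne h
    rw [div_pow, sqrtBr_sq]
    field_simp
  have hre := sqrtBr_div_re_pos h
  rw [← hsq, mem_slitPlane_iff, pow_two, mul_re, mul_im]
  by_contra! hc
  have : (sqrtBr ζ / ζ).im = 0 := by
    have := hc.2
    nlinarith [mul_self_nonneg (sqrtBr ζ / ζ).im, mul_self_nonneg (sqrtBr ζ / ζ).re]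
  rw [this] at hc
  nlinarith [hc.1]

lemma szegoD_eq {α : ℝ} {ζ : ℂ} (h : ζ ∉ segOne) :
    szegoD α ζ = ((1 - ζ⁻¹ ^ 2) ^ (2⁻¹ : ℂ) - I * ζ⁻¹) ^ (α : ℂ) := by
  rw [← sqrtBr_div_eq h, szegoD]
  congr 1
  ring

lemma analyticOnNhd_szegoD (α : ℝ) : AnalyticOnNhd ℂ (szegoD α) segOneᶜ := by
  intro ζ h
  have hinv : AnalyticAt ℂ (fun z : ℂ => z⁻¹) ζ := analyticAt_inv (ne_zero_of_notMem_segOne h)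
  have hbase : (1 - ζ⁻¹ ^ 2) ^ (2⁻¹ : ℂ) - I * ζ⁻¹ ∈ slitPlane := by
    rw [← sqrtBr_div_eq h]
    convert szegoD_base_mem_slitPlane h using 1
    ring
  have hF : AnalyticAt ℂ
      (fun z : ℂ => ((1 - z⁻¹ ^ 2) ^ (2⁻¹ : ℂ) - I * z⁻¹) ^ (α : ℂ)) ζ :=
    (((analyticAt_const.sub (hinv.pow 2)).cpow analyticAt_const
      (one_sub_inv_sq_mem_slitPlane h)).sub (analyticAt_const.mul hinv)).cpow
      analyticAt_const hbase
  refine hF.congr ?_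
  filter_upwards [isOpen_segOne_compl.mem_nhds h] with z hz
  exact (szegoD_eq hz).symm

lemma szegoD_ne_zero {α : ℝ} {ζ : ℂ} (h : ζ ∉ segOne) : szegoD α ζ ≠ 0 := by
  rw [szegoD, cpow_def_of_ne_zero (slitPlane_ne_zero (szegoD_base_mem_slitPlane h))]
  exact Complex.exp_ne_zero _

lemma tendsto_one_sub_sq_cpow {x : ℝ} (hx : |x| < 1) {u : ℝ → ℂ}
    (hu : Tendsto u (𝓝[>] 0) (𝓝 (x : ℂ))) :
    Tendsto (fun ε => (1 - u ε ^ 2) ^ (2⁻¹ : ℂ)) (𝓝[>] 0)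
      (𝓝 ((√(1 - x ^ 2) : ℝ) : ℂ)) := by
  have hpos : 0 < 1 - x ^ 2 := by
    have := (sq_lt_one_iff_abs_lt_one x).2 hx
    linarith
  have e : (((√(1 - x ^ 2) : ℝ)) : ℂ) = (1 - (x : ℂ) ^ 2) ^ (2⁻¹ : ℂ) := by
    rw [Real.sqrt_eq_rpow, ofReal_cpow hpos.le]
    push_cast
    norm_num
  rw [e]
  refine ((continuousAt_cpow_const ?_).tendsto).comp (tendsto_const_nhds.sub (hu.pow 2))
  left
  exact_mod_cast hpos

lemma tendsto_szegoD_above (α : ℝ) {x : ℝ} (hx : |x| < 1) (h0 : x ≠ 0) :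
    Tendsto (fun ε : ℝ => szegoD α ((x : ℂ) + ε * I)) (𝓝[>] 0)
      (𝓝 ((((-(1 - √(1 - x ^ 2)) / x : ℝ) : ℂ) * I) ^ (α : ℂ))) := by
  have hu : Tendsto (fun ε : ℝ => (x : ℂ) + ε * I) (𝓝[>] 0) (𝓝 (x : ℂ)) := by
    have : Continuous fun ε : ℝ => (x : ℂ) + ε * I := by fun_prop
    simpa using (this.tendsto 0).mono_left nhdsWithin_le_nhds
  have hsq : √(1 - x ^ 2) ≠ 1 := by
    rw [Ne, Real.sqrt_eq_one]
    simpa using h0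
  have hlim : (((-(1 - √(1 - x ^ 2)) / x : ℝ) : ℂ) * I)
      = (-I + I * ((√(1 - x ^ 2) : ℝ) : ℂ)) / x := by
    push_cast
    ring
  have hmem : (((-(1 - √(1 - x ^ 2)) / x : ℝ) : ℂ) * I) ∈ slitPlane := by
    right
    rw [im_ofReal_mul, I_im, mul_one]
    exact div_ne_zero (neg_ne_zero.2 (sub_ne_zero.2 hsq.symm)) h0
  refine (continuousAt_cpow_const hmem).tendsto.comp ?_
  rw [hlim]
  have := (((tendsto_one_sub_sq_cpow hx hu).const_mul I).const_add (-I)).div hu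
    (by exact_mod_cast h0)
  refine this.congr' ?_
  filter_upwards [self_mem_nhdsWithin] with ε hε
  rw [Set.mem_Ioi] at hε
  simp only [Pi.div_apply]
  rw [sqrtBr_of_im_pos (by simpa using hε)]

lemma tendsto_szegoD_below (α : ℝ) {x : ℝ} (hx : |x| < 1) (h0 : x ≠ 0) :
    Tendsto (fun ε : ℝ => szegoD α ((x : ℂ) - ε * I)) (𝓝[>] 0)
      (𝓝 ((((-(1 + √(1 - x ^ 2)) / x : ℝ) : ℂ) * I) ^ (α : ℂ))) := by
  have hu : Tendsto (fun ε : ℝ => (x : ℂ) - ε * I) (𝓝[>] 0) (𝓝 (x : ℂ)) := by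
    have : Continuous fun ε : ℝ => (x : ℂ) - ε * I := by fun_prop
    simpa using (this.tendsto 0).mono_left nhdsWithin_le_nhds
  have hlim : (((-(1 + √(1 - x ^ 2)) / x : ℝ) : ℂ) * I)
      = (-I + -I * ((√(1 - x ^ 2) : ℝ) : ℂ)) / x := by
    push_cast
    ring
  have hmem : (((-(1 + √(1 - x ^ 2)) / x : ℝ) : ℂ) * I) ∈ slitPlane := by
    right
    rw [im_ofReal_mul, I_im, mul_one]
    have := Real.sqrt_nonneg (1 - x ^ 2)
    exact div_ne_zero (neg_ne_zero.2 (by linarith)) h0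
  refine (continuousAt_cpow_const hmem).tendsto.comp ?_
  rw [hlim]
  have := (((tendsto_one_sub_sq_cpow hx hu).const_mul (-I)).const_add (-I)).div hu
    (by exact_mod_cast h0)
  refine this.congr' ?_
  filter_upwards [self_mem_nhdsWithin] with ε hε
  rw [Set.mem_Ioi] at hε
  simp only [Pi.div_apply]
  rw [sqrtBr_of_im_neg (by simpa using hε)]

lemma ofReal_mul_cpow_mul_ofReal_mul_cpow {a b : ℝ} (ha : 0 < a) (hb : 0 < b) (hab : a * b = 1)
    {c : ℂ} (hc : c ≠ 0) (s : ℂ) :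
    ((a : ℂ) * c) ^ s * ((b : ℂ) * c) ^ s = Complex.exp (2 * log c * s) := by
  have ha' : (a : ℂ) ≠ 0 := by exact_mod_cast ha.ne'
  have hb' : (b : ℂ) ≠ 0 := by exact_mod_cast hb.ne'
  have hlog : ((Real.log a : ℝ) : ℂ) + ((Real.log b : ℝ) : ℂ) = 0 := by
    rw [← ofReal_add, ← Real.log_mul ha.ne' hb.ne', hab, Real.log_one, ofReal_zero]
  rw [cpow_def_of_ne_zero (mul_ne_zero ha' hc), cpow_def_of_ne_zero (mul_ne_zero hb' hc),
    log_ofReal_mul ha hc, log_ofReal_mul hb hc, ← Complex.exp_add]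
  congr 1
  linear_combination s * hlog

lemma sqrt_one_sub_sq_lt_one {x : ℝ} (h0 : x ≠ 0) : √(1 - x ^ 2) < 1 := by
  rw [Real.sqrt_lt' one_pos]
  have := pow_pos (abs_pos.2 h0) 2
  rw [sq_abs] at this
  linarith

lemma boundary_values_mul {x : ℝ} (hx : |x| < 1) (h0 : x ≠ 0) :
    ((1 - √(1 - x ^ 2)) / x) * ((1 + √(1 - x ^ 2)) / x) = 1 := by
  have hs : √(1 - x ^ 2) ^ 2 = 1 - x ^ 2 :=
    Real.sq_sqrt (by have := (sq_lt_one_iff_abs_lt_one x).2 hx; linarith)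
  field_simp
  linear_combination -hs

lemma szegoD_jump_neg (α : ℝ) {x : ℝ} (hx : x ∈ Set.Ioo (-1 : ℝ) 0) :
    (((-(1 - √(1 - x ^ 2)) / x : ℝ) : ℂ) * I) ^ (α : ℂ) *
      (((-(1 + √(1 - x ^ 2)) / x : ℝ) : ℂ) * I) ^ (α : ℂ) =
        Complex.exp (I * Real.pi * α) := by
  have h0 := hx.2.ne
  have hx1 : |x| < 1 := abs_lt.2 ⟨hx.1, hx.2.trans one_pos⟩
  have hs := sqrt_one_sub_sq_lt_one h0
  have hs' := Real.sqrt_nonneg (1 - x ^ 2)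
  rw [ofReal_mul_cpow_mul_ofReal_mul_cpow
    (div_pos_of_neg_of_neg (by linarith) hx.2) (div_pos_of_neg_of_neg (by linarith) hx.2)
    (by rw [neg_div, neg_div, neg_mul_neg]; exact boundary_values_mul hx1 h0) I_ne_zero, log_I]
  ring_nf

lemma szegoD_jump_pos (α : ℝ) {x : ℝ} (hx : x ∈ Set.Ioo (0 : ℝ) 1) :
    (((-(1 - √(1 - x ^ 2)) / x : ℝ) : ℂ) * I) ^ (α : ℂ) *
      (((-(1 + √(1 - x ^ 2)) / x : ℝ) : ℂ) * I) ^ (α : ℂ) =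
        Complex.exp (-(I * Real.pi * α)) := by
  have h0 := hx.1.ne'
  have hx1 : |x| < 1 := abs_lt.2 ⟨by linarith [hx.1], hx.2⟩
  have hs := sqrt_one_sub_sq_lt_one h0
  have hs' := Real.sqrt_nonneg (1 - x ^ 2)
  have e (a : ℝ) : ((-a / x : ℝ) : ℂ) * I = ((a / x : ℝ) : ℂ) * -I := by
    rw [neg_div]
    push_cast
    ring
  rw [e, e, ofReal_mul_cpow_mul_ofReal_mul_cpow
    (div_pos (by linarith) hx.1) (div_pos (by linarith) hx.1)
    (boundary_values_mul hx1 h0) (neg_ne_zero.2 I_ne_zero), log_neg_I]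
  ring_nf

lemma AnalyticAt.isBigO_sub_deriv {f : ℂ → ℂ} (hf : AnalyticAt ℂ f 0) :
    (fun w => f w - (f 0 + deriv f 0 * w)) =O[𝓝 0] fun w => w ^ 2 := by
  obtain ⟨p, hp⟩ := hf
  have hd := hp.has_fpower_series_dslope_fslope.differentiableAt.isBigO_sub
  have := (Asymptotics.isBigO_refl (fun w : ℂ => w) (𝓝 0)).mul hd
  refine this.congr (fun w => ?_) (fun w => by ring)
  have h := sub_smul_dslope f 0 w
  rw [sub_zero, smul_eq_mul] at h
  rw [dslope_same, mul_sub, h]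
  ring

lemma szegoD_expansion_infty (α : ℝ) :
    ∃ C : ℝ, 0 < C ∧ ∃ R : ℝ, 0 < R ∧ ∀ ζ : ℂ, R ≤ ‖ζ‖ →
      ‖szegoD α ζ - (1 - I * α / ζ)‖ ≤ C / ‖ζ‖ ^ 2 := by
  set F : ℂ → ℂ := fun w => ((1 - w ^ 2) ^ (2⁻¹ : ℂ) - I * w) ^ (α : ℂ) with hF
  have hFan : AnalyticAt ℂ F 0 :=
    (((analyticAt_const.sub (analyticAt_id.pow 2)).cpow analyticAt_const (by simp)).sub
      (analyticAt_const.mul analyticAt_id)).cpow analyticAt_const (by simp)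
  have hF0 : F 0 = 1 := by simp [hF]
  have hd : deriv F 0 = -(I * α) := by
    have h1 : HasDerivAt (fun w : ℂ => 1 - w ^ 2) 0 0 := by
      simpa using ((hasDerivAt_id (0 : ℂ)).pow 2).const_sub 1
    have h2 : HasDerivAt (fun w : ℂ => (1 - w ^ 2) ^ (2⁻¹ : ℂ) - I * w) (-I) 0 := by
      simpa using (h1.cpow_const (c := 2⁻¹) (by simp)).fun_sub ((hasDerivAt_id (0 : ℂ)).const_mul I)
    have h3 := h2.cpow_const (c := (α : ℂ)) (by simp)
    rw [h3.deriv]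
    simp [mul_comm]
  obtain ⟨C, hC, hb⟩ := hFan.isBigO_sub_deriv.exists_pos
  obtain ⟨ε, hε, hball⟩ := Metric.eventually_nhds_iff.1 hb.bound
  refine ⟨C, hC, max 2 (2 / ε), by positivity, fun ζ hζ => ?_⟩
  have h2 : 2 ≤ ‖ζ‖ := (le_max_left _ _).trans hζ
  have hε' : 2 / ε ≤ ‖ζ‖ := (le_max_right _ _).trans hζ
  have hnot : ζ ∉ segOne := by
    rintro ⟨x, hx, rfl⟩
    rw [norm_real, Real.norm_eq_abs] at h2
    linarith [abs_le.2 hx]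
  have hsmall : dist ζ⁻¹ 0 < ε := by
    rw [dist_zero_right, norm_inv, inv_lt_comm₀ (by linarith) hε]
    refine lt_of_lt_of_le ?_ hε'
    rw [← one_div]
    gcongr
    norm_num
  have := hball hsmall
  rw [hF0, hd] at this
  rw [szegoD_eq hnot]
  convert this using 1
  · congr 2
    ring
  · rw [norm_pow, norm_inv]
    ring

lemma mul_cpow_of_abs_arg {c h : ℂ} (hc0 : c ≠ 0) (hc : |c.arg| ≤ Real.pi / 2)
    (hh : 0 < h.re) (s : ℂ) : (c * h) ^ s = c ^ s * h ^ s := by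
  have hh0 : h ≠ 0 := fun h0 => by simp [h0] at hh
  obtain ⟨h1, h2⟩ := abs_lt.1 (abs_arg_lt_pi_div_two_iff.2 (.inl hh))
  obtain ⟨h3, h4⟩ := abs_le.1 hc
  rw [cpow_def_of_ne_zero (mul_ne_zero hc0 hh0), cpow_def_of_ne_zero hc0,
    cpow_def_of_ne_zero hh0, log_mul hc0 hh0 ⟨by linarith, by linarith⟩, add_mul,
    Complex.exp_add]

lemma neg_I_cpow (α : ℝ) : (-I) ^ (α : ℂ) = Complex.exp (-(I * Real.pi * α) / 2) := by
  rw [cpow_def_of_ne_zero (neg_ne_zero.2 I_ne_zero), log_neg_I]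
  ring_nf

lemma I_cpow (α : ℝ) : I ^ (α : ℂ) = Complex.exp (I * Real.pi * α / 2) := by
  rw [cpow_def_of_ne_zero I_ne_zero, log_I]
  ring_nf

lemma exists_norm_cpow_sub_one_le (s : ℂ) :
    ∃ C : ℝ, 0 < C ∧ ∃ η : ℝ, 0 < η ∧ ∀ h : ℂ, ‖h - 1‖ < η →
      ‖h ^ s - 1‖ ≤ C * ‖h - 1‖ := by
  have hd : DifferentiableAt ℂ (fun h : ℂ => h ^ s) 1 :=
    differentiableAt_id.cpow_const (by simp)
  obtain ⟨C, hC, hb⟩ := hd.isBigO_sub.exists_pos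
  obtain ⟨η, hη, hball⟩ := Metric.eventually_nhds_iff.1 hb.bound
  refine ⟨C, hC, η, hη, fun h hh => ?_⟩
  simpa using hball (by rwa [dist_eq_norm])

lemma re_pos_of_norm_sub_one_lt {h : ℂ} (hh : ‖h - 1‖ < 1) : 0 < h.re := by
  have := (abs_le.1 (abs_re_le_norm (h - 1))).1
  rw [sub_re, one_re] at this
  linarith

lemma norm_one_add_I_mul_div_sub_one_le {σ s : ℂ} (hs : s ^ 2 = σ ^ 2 - 1)
    (hσ : ‖σ - 1‖ < 1 / 4) :
    ‖s‖ ^ 2 ≤ 3 * ‖σ - 1‖ ∧ ‖(1 + I * s) / σ - 1‖ ≤ 4 * ‖s‖ := by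
  have h1 : 3 / 4 ≤ ‖σ‖ := by
    have := norm_sub_norm_le 1 (1 - σ)
    rw [sub_sub_cancel, norm_one, norm_sub_rev] at this
    linarith
  have h2 : 1 ≤ ‖σ + 1‖ := by
    have := norm_sub_norm_le 2 (1 - σ)
    rw [show (2 : ℂ) - (1 - σ) = σ + 1 by ring, norm_sub_rev 1, Complex.norm_two] at this
    linarith
  have h3 : ‖σ + 1‖ ≤ 3 := by
    have := norm_add_le 2 (σ - 1)
    rw [show (2 : ℂ) + (σ - 1) = σ + 1 by ring, Complex.norm_two] at this
    linarith
  have hn : ‖s‖ ^ 2 = ‖σ + 1‖ * ‖σ - 1‖ := by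
    rw [← norm_pow, hs, ← norm_mul]
    congr 1
    ring
  have hn' : ‖s‖ ^ 2 ≤ 3 * ‖σ - 1‖ := by
    rw [hn]
    gcongr
  refine ⟨hn', ?_⟩
  have hs1 : ‖s‖ ≤ 1 := by nlinarith [norm_nonneg s]
  have hσs : ‖σ - 1‖ ≤ ‖s‖ := by nlinarith [norm_nonneg s, norm_nonneg (σ - 1)]
  have hσ0 : σ ≠ 0 := norm_pos_iff.1 (by linarith)
  have e : (1 + I * s) / σ - 1 = (I * s - (σ - 1)) / σ := by
    field_simp
    ring
  rw [e, norm_div, div_le_iff₀ (by linarith)]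
  have := norm_sub_le (I * s) (σ - 1)
  rw [norm_mul, norm_I, one_mul] at this
  nlinarith [norm_nonneg s]

/-- With `e = ±1` and `c = -I / e`, this covers both endpoints; no half-plane restriction is needed. -/
lemma szegoD_near_endpoint (α : ℝ) {e c : ℂ} (he : e ^ 2 = 1) (hc0 : c ≠ 0)
    (hc : |c.arg| ≤ Real.pi / 2) (hce : c * e = -I) :
    ∃ C : ℝ, 0 < C ∧ ∃ δ : ℝ, 0 < δ ∧ ∀ ζ : ℂ, ‖ζ - e‖ < δ →
      ∃ ρ : ℂ, szegoD α ζ = c ^ (α : ℂ) * (1 + ρ) ∧ ‖ρ‖ ≤ C * ‖sqrtBr ζ‖ := by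
  obtain ⟨C, hC, η, hη, hb⟩ := exists_norm_cpow_sub_one_le (α : ℂ)
  have he1 : ‖e‖ = 1 := by
    have := congrArg norm he
    rw [norm_pow, norm_one] at this
    exact (pow_eq_one_iff_of_nonneg (norm_nonneg e) two_ne_zero).1 this
  set m := min η 1 with hm
  have hm0 : 0 < m := lt_min hη one_pos
  refine ⟨4 * C, by positivity, min (1 / 4) (m ^ 2 / 48), by positivity, fun ζ hζ => ?_⟩
  have hdist : ‖e * ζ - 1‖ = ‖ζ - e‖ := by
    rw [show e * ζ - 1 = e * (ζ - e) by linear_combination he, norm_mul, he1, one_mul]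
  have hs : sqrtBr ζ ^ 2 = (e * ζ) ^ 2 - 1 := by
    rw [mul_pow, he, one_mul, sqrtBr_sq]
  obtain ⟨hs2, hh⟩ := norm_one_add_I_mul_div_sub_one_le hs
    (by rw [hdist]; exact hζ.trans_le (min_le_left _ _))
  rw [hdist] at hs2
  set h := (1 + I * sqrtBr ζ) / (e * ζ) with hdef
  have hlt : ‖h - 1‖ < m := by
    refine hh.trans_lt (lt_of_pow_lt_pow_left₀ 2 hm0.le ?_)
    have := hζ.trans_le (min_le_right _ _)
    rw [mul_pow]
    linarith
  have hbase : (-I + sqrtBr ζ) / ζ = c * h := by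
    have he0 : e ≠ 0 := fun h0 => by simp [h0] at he
    have hc' : c = -I * e := by linear_combination e * hce - c * he
    rw [hdef, hc', mul_comm (-I) e, mul_assoc, ← mul_div_assoc, ← mul_div_assoc,
      mul_div_mul_left _ _ he0]
    congr 1
    linear_combination sqrtBr ζ * I_sq
  refine ⟨h ^ (α : ℂ) - 1, ?_, ?_⟩
  · rw [szegoD, hbase, mul_cpow_of_abs_arg hc0 hc
      (re_pos_of_norm_sub_one_lt (hlt.trans_le (min_le_right _ _)))]
    ring
  · calc ‖h ^ (α : ℂ) - 1‖ ≤ C * ‖h - 1‖ := hb h (hlt.trans_le (min_le_left _ _))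
      _ ≤ C * (4 * ‖sqrtBr ζ‖) := by gcongr
      _ = 4 * C * ‖sqrtBr ζ‖ := by ring

lemma szegoD_near_zero (α : ℝ) :
    ∃ C : ℝ, 0 < C ∧ ∃ δ : ℝ, 0 < δ ∧ ∀ ζ : ℂ, ‖ζ‖ < δ → 0 < ζ.im →
      ∃ ρ : ℂ, szegoD α ζ = Complex.exp (-(I * Real.pi * α) / 2) * (ζ / 2) ^ (α : ℂ) * (1 + ρ) ∧
        ‖ρ‖ ≤ C * ‖ζ‖ := by
  obtain ⟨C, hC, η, hη, hb⟩ := exists_norm_cpow_sub_one_le (α : ℂ)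
  refine ⟨C, hC, min η 1, lt_min hη one_pos, fun ζ hζ him => ?_⟩
  have hζ0 : ζ ≠ 0 := fun h0 => by simp [h0] at him
  have hζ1 : ‖ζ‖ < 1 := hζ.trans_le (min_le_right _ _)
  have hs := sqrtBr_im_pos him
  have hsI : 1 ≤ ‖sqrtBr ζ + I‖ := by
    have := (le_abs_self _).trans (abs_im_le_norm (sqrtBr ζ + I))
    rw [add_im, I_im] at this
    linarith
  have hsI0 : sqrtBr ζ + I ≠ 0 := norm_pos_iff.1 (by linarith)
  set h := 2 * I / (sqrtBr ζ + I) with hdef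
  have hh : ‖h - 1‖ ≤ ‖ζ‖ := by
    have e : h - 1 = -(ζ / (sqrtBr ζ + I)) ^ 2 := by
      rw [hdef, div_pow, ← sqrtBr_add_I_mul_sub_I]
      field_simp
      ring
    rw [e, norm_neg, norm_pow, norm_div]
    have h1 : ‖ζ‖ / ‖sqrtBr ζ + I‖ ≤ ‖ζ‖ := div_le_self (norm_nonneg _) hsI
    have h2 : 0 ≤ ‖ζ‖ / ‖sqrtBr ζ + I‖ := by positivity
    nlinarith
  have hbase : (-I + sqrtBr ζ) / ζ = -I * (ζ / 2) * h := by
    rw [hdef, div_eq_iff hζ0]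
    field_simp
    linear_combination sqrtBr_add_I_mul_sub_I ζ + ζ ^ 2 * I_sq
  have hre : 0 < (-I * (ζ / 2)).re := by
    have : -I * (ζ / 2) = ((1 / 2 : ℝ) : ℂ) * (-I * ζ) := by push_cast; ring
    rw [this, re_ofReal_mul]
    simpa using him
  have hsplit : (-I * (ζ / 2)) ^ (α : ℂ) = (-I) ^ (α : ℂ) * (ζ / 2) ^ (α : ℂ) := by
    have h20 : ζ / 2 ≠ 0 := div_ne_zero hζ0 two_ne_zero
    have him2 : 0 < (ζ / 2).im := by
      rw [show ζ / 2 = ((1 / 2 : ℝ) : ℂ) * ζ by push_cast; ring, im_ofReal_mul]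
      linarith
    obtain ⟨a1, a2⟩ := arg_mem_Ioo_of_im_pos him2
    have hnI : -I ≠ 0 := neg_ne_zero.2 I_ne_zero
    rw [cpow_def_of_ne_zero (mul_ne_zero hnI h20), cpow_def_of_ne_zero hnI,
      cpow_def_of_ne_zero h20, log_mul hnI h20
        ⟨by rw [arg_neg_I]; linarith, by rw [arg_neg_I]; linarith⟩, add_mul, Complex.exp_add]
  refine ⟨h ^ (α : ℂ) - 1, ?_, ?_⟩
  · rw [szegoD, hbase, mul_cpow_of_abs_arg (fun h0 => by simp [h0] at hre)
      (abs_arg_le_pi_div_two_iff.2 hre.le) (re_pos_of_norm_sub_one_lt (hh.trans_lt hζ1)),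
      hsplit, neg_I_cpow]
    ring
  · exact (hb h (hh.trans_lt (hζ.trans_le (min_le_left _ _)))).trans (by gcongr)

/-- Properties of the Szegő function `D(ζ) = ((−i + √(ζ²−1))/ζ)^α`:
analyticity and nonvanishing off `[−1, 1]`, the multiplicative jump relations
`D₊D₋ = e^{±iπα}` on `(−1, 0)` and `(0, 1)`, the expansion
`D(ζ) = 1 − iα/ζ + O(1/ζ²)` at infinity, and the local behavior at the
origin and at `ζ = ±1` from the upper half-plane. -/
theorem szegoD_properties (α : ℝ) :
    -- (i) analytic and nonvanishing off [−1, 1]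
    AnalyticOnNhd ℂ (szegoD α) segOneᶜ ∧
    (∀ ζ ∈ segOneᶜ, szegoD α ζ ≠ 0) ∧
    -- (ii) boundary values: D₊(x)D₋(x) = e^{iπα} on (−1,0), e^{−iπα} on (0,1)
    (∀ x : ℝ, x ∈ Set.Ioo (-1 : ℝ) 0 →
      ∃ Dp Dm : ℂ,
        Tendsto (fun ε : ℝ => szegoD α ((x : ℂ) + ε * Complex.I))
          (nhdsWithin 0 (Set.Ioi 0)) (nhds Dp) ∧
        Tendsto (fun ε : ℝ => szegoD α ((x : ℂ) - ε * Complex.I))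
          (nhdsWithin 0 (Set.Ioi 0)) (nhds Dm) ∧
        Dp * Dm = Complex.exp (Complex.I * Real.pi * α)) ∧
    (∀ x : ℝ, x ∈ Set.Ioo (0 : ℝ) 1 →
      ∃ Dp Dm : ℂ,
        Tendsto (fun ε : ℝ => szegoD α ((x : ℂ) + ε * Complex.I))
          (nhdsWithin 0 (Set.Ioi 0)) (nhds Dp) ∧
        Tendsto (fun ε : ℝ => szegoD α ((x : ℂ) - ε * Complex.I))
          (nhdsWithin 0 (Set.Ioi 0)) (nhds Dm) ∧
        Dp * Dm = Complex.exp (-(Complex.I * Real.pi * α))) ∧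
    -- (iii) D(ζ) = 1 − iα/ζ + O(1/ζ²) as ζ → ∞
    (∃ C : ℝ, 0 < C ∧ ∃ R : ℝ, 0 < R ∧ ∀ ζ : ℂ, R ≤ ‖ζ‖ →
      ‖szegoD α ζ - (1 - Complex.I * α / ζ)‖ ≤ C / ‖ζ‖ ^ 2) ∧
    -- (iv) D(ζ) = e^{−iπα/2}(ζ/2)^α(1 + O(ζ)) as ζ → 0, Im ζ > 0
    (∃ C : ℝ, 0 < C ∧ ∃ δ : ℝ, 0 < δ ∧ ∀ ζ : ℂ, ‖ζ‖ < δ → 0 < ζ.im →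
      ∃ ρ : ℂ, szegoD α ζ
          = Complex.exp (-(Complex.I * Real.pi * α) / 2) * (ζ / 2) ^ (α : ℂ)
              * (1 + ρ) ∧
        ‖ρ‖ ≤ C * ‖ζ‖) ∧
    -- (v) D(ζ) = e^{∓iπα/2}(1 + O(√(ζ²−1))) as ζ → ±1, Im ζ > 0
    (∃ C : ℝ, 0 < C ∧ ∃ δ : ℝ, 0 < δ ∧ ∀ ζ : ℂ, ‖ζ - 1‖ < δ → 0 < ζ.im →
      ∃ ρ : ℂ, szegoD α ζ
          = Complex.exp (-(Complex.I * Real.pi * α) / 2) * (1 + ρ) ∧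
        ‖ρ‖ ≤ C * ‖sqrtBr ζ‖) ∧
    (∃ C : ℝ, 0 < C ∧ ∃ δ : ℝ, 0 < δ ∧ ∀ ζ : ℂ, ‖ζ + 1‖ < δ → 0 < ζ.im →
      ∃ ρ : ℂ, szegoD α ζ
          = Complex.exp (Complex.I * Real.pi * α / 2) * (1 + ρ) ∧
        ‖ρ‖ ≤ C * ‖sqrtBr ζ‖) := by
  refine ⟨analyticOnNhd_szegoD α, fun ζ hζ => szegoD_ne_zero hζ, fun x hx => ?_, fun x hx => ?_,
    szegoD_expansion_infty α, szegoD_near_zero α, ?_, ?_⟩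
  · have hx1 : |x| < 1 := abs_lt.2 ⟨hx.1, hx.2.trans one_pos⟩
    exact ⟨_, _, tendsto_szegoD_above α hx1 hx.2.ne, tendsto_szegoD_below α hx1 hx.2.ne,
      szegoD_jump_neg α hx⟩
  · have hx1 : |x| < 1 := abs_lt.2 ⟨by linarith [hx.1], hx.2⟩
    exact ⟨_, _, tendsto_szegoD_above α hx1 hx.1.ne', tendsto_szegoD_below α hx1 hx.1.ne',
      szegoD_jump_pos α hx⟩
  · obtain ⟨C, hC, δ, hδ, h⟩ := szegoD_near_endpoint α (e := 1) (c := -I) (by norm_num)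
      (neg_ne_zero.2 I_ne_zero) (abs_arg_le_pi_div_two_iff.2 (by simp)) (by ring)
    rw [neg_I_cpow] at h
    exact ⟨C, hC, δ, hδ, fun ζ hζ _ => h ζ hζ⟩
  · obtain ⟨C, hC, δ, hδ, h⟩ := szegoD_near_endpoint α (e := -1) (c := I) (by norm_num)
      I_ne_zero (abs_arg_le_pi_div_two_iff.2 (by simp)) (by ring)
    rw [I_cpow] at h
    exact ⟨C, hC, δ, hδ, fun ζ hζ _ => h ζ (by rwa [sub_neg_eq_add])⟩
end
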